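/- Complex product formula: let F, G ∈ ℂ[X,Y] be polynomials in two real variables and let Γ ⊂ ℂ be a rectangle such that neither F nor G vanishes at any of the four vertices of Γ. Then ind_{∂Γ}(F·G) = ind_{∂Γ}(F) + ind_{∂Γ}(G). -/

import Mathlib

open Polynomial

/-- The value at `x` of the "unit part" of `P` after removing the factor `(X - x)^m`,
where `m` is the multiplicity of `x` as a root of `P`. Nonzero whenever `P ≠ 0`. -/
noncomputable def unitEval (P : Polynomial ℝ) (x : ℝ) : ℝ :=
  (P /ₘ (X - C x) ^ rootMultiplicity x P).eval x

/-- One-sided Cauchy index `Ind_x^+` of the rational function `R/S` at `x`. -/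
noncomputable def indPlus (R S : Polynomial ℝ) (x : ℝ) : ℝ :=
  if (rootMultiplicity x R : ℤ) < (rootMultiplicity x S : ℤ) then
    (1 / 2) * Real.sign (unitEval R x * unitEval S x)
  else 0

/-- One-sided Cauchy index `Ind_x^-` of the rational function `R/S` at `x`. -/
noncomputable def indMinus (R S : Polynomial ℝ) (x : ℝ) : ℝ :=
  if (rootMultiplicity x R : ℤ) < (rootMultiplicity x S : ℤ) then
    (1 / 2) * (-1 : ℝ) ^ (rootMultiplicity x S - rootMultiplicity x R) *
      Real.sign (unitEval R x * unitEval S x)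
  else 0

/-- Local Cauchy index `Ind_x(R/S) = Ind_x^+(R/S) - Ind_x^-(R/S)`. -/
noncomputable def indPoint (R S : Polynomial ℝ) (x : ℝ) : ℝ :=
  indPlus R S x - indMinus R S x

/-- The Cauchy index `Ind_a^b(R/S)` of the rational function `R/S` on `[a, b]`:
`Ind_a^+(R/S) + Σ_{x ∈ (a,b)} Ind_x(R/S) - Ind_b^-(R/S)`, with the convention that
it is `0` when `R = 0` or `S = 0`.  (Only poles, i.e. roots of `S`, contribute to
the middle sum.) -/
noncomputable def cauchyIndex (R S : Polynomial ℝ) (a b : ℝ) : ℝ :=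
  if R = 0 ∨ S = 0 then 0
  else indPlus R S a +
      (∑ x ∈ S.roots.toFinset, if a < x ∧ x < b then indPoint R S x else 0) -
      indMinus R S b

/-- Number of sign changes `V(s_0, …, s_n) = Σ ½|sign s_{k-1} - sign s_k|` of a list of reals. -/
noncomputable def signVar : List ℝ → ℝ
  | [] => 0
  | [_] => 0
  | a :: b :: l => (1 / 2) * |Real.sign a - Real.sign b| + signVar (b :: l)

/-- Sign changes `V_x(S_0, …, S_n)` of a list of real polynomials evaluated at `x`. -/
noncomputable def signVarAt (L : List (Polynomial ℝ)) (x : ℝ) : ℝ :=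
  signVar (L.map fun P => P.eval x)

/-- Real part of a complex polynomial, coefficientwise. -/
noncomputable def rePoly (p : Polynomial ℂ) : Polynomial ℝ :=
  p.sum fun n c => Polynomial.C c.re * Polynomial.X ^ n

/-- Imaginary part of a complex polynomial, coefficientwise. -/
noncomputable def imPoly (p : Polynomial ℂ) : Polynomial ℝ :=
  p.sum fun n c => Polynomial.C c.im * Polynomial.X ^ n

/-- For `F ∈ ℂ[X,Y]` (two real variables, identifying `ℂ` with `ℝ²`), the one-variable
polynomial `F̂ ∈ ℂ[T]` obtained by substituting the affine parametrization
`t ↦ a + t(b - a)` of the segment from `a` to `b`, i.e.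
`X ↦ re a + t(re b - re a)` and `Y ↦ im a + t(im b - im a)`. -/
noncomputable def segPolyXY (F : MvPolynomial (Fin 2) ℂ) (a b : ℂ) : Polynomial ℂ :=
  MvPolynomial.aeval (fun j : Fin 2 =>
    if j = 0 then Polynomial.C (a.re : ℂ) + Polynomial.C ((b.re - a.re : ℝ) : ℂ) * Polynomial.X
    else Polynomial.C (a.im : ℂ) + Polynomial.C ((b.im - a.im : ℝ) : ℂ) * Polynomial.X) F

/-- The index `ind_{[a,b]}(F) = ½ · Ind_0^1(re F̂ / im F̂)` of `F ∈ ℂ[X,Y]` along the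
segment from `a` to `b`. -/
noncomputable def segIndexXY (F : MvPolynomial (Fin 2) ℂ) (a b : ℂ) : ℝ :=
  (1 / 2) * cauchyIndex (rePoly (segPolyXY F a b)) (imPoly (segPolyXY F a b)) 0 1

/-- The algebraic index `ind_{∂Γ}(F)` of `F ∈ ℂ[X,Y]` along the positively oriented
boundary of the rectangle `Γ = [x₀,x₁] × [y₀,y₁] ⊂ ℂ`. -/
noncomputable def rectIndexXY (F : MvPolynomial (Fin 2) ℂ) (x₀ x₁ y₀ y₁ : ℝ) : ℝ :=
  segIndexXY F (x₀ + y₀ * Complex.I) (x₁ + y₀ * Complex.I) +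
  segIndexXY F (x₁ + y₀ * Complex.I) (x₁ + y₁ * Complex.I) +
  segIndexXY F (x₁ + y₁ * Complex.I) (x₀ + y₁ * Complex.I) +
  segIndexXY F (x₀ + y₁ * Complex.I) (x₀ + y₀ * Complex.I)

/-- Evaluation of `F ∈ ℂ[X,Y]` at a point `(x, y) ∈ ℝ²`. -/
noncomputable def evalXY (F : MvPolynomial (Fin 2) ℂ) (x y : ℝ) : ℂ :=
  MvPolynomial.eval (fun j : Fin 2 => if j = 0 then (x : ℂ) else (y : ℂ)) F

open Filter Topology

section RealSign

lemma Real.sign_mul' (a b : ℝ) : Real.sign (a * b) = Real.sign a * Real.sign b := by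
  rcases lt_trichotomy a 0 with ha | rfl | ha <;> rcases lt_trichotomy b 0 with hb | rfl | hb <;>
    simp [Real.sign_of_neg, Real.sign_of_pos, mul_pos_of_neg_of_neg, mul_neg_of_neg_of_pos,
      mul_neg_of_pos_of_neg, *]

lemma Real.sign_mul_self_of_ne_zero {a : ℝ} (ha : a ≠ 0) : Real.sign a * Real.sign a = 1 := by
  rcases Real.sign_apply_eq_of_ne_zero a ha with h | h <;> simp [h]

lemma Real.sign_pos_combination {A B : ℝ} (hA : 0 < A) (hB : 0 < B) (a b : ℝ) :
    Real.sign (A * a + B * b) - Real.sign a - Real.sign b =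
      -(Real.sign a * Real.sign b * Real.sign (A * a + B * b)) := by
  rcases lt_trichotomy a 0 with ha | rfl | ha <;> rcases lt_trichotomy b 0 with hb | rfl | hb
  · rw [Real.sign_of_neg ha, Real.sign_of_neg hb, Real.sign_of_neg (by nlinarith)]; norm_num
  · simp [Real.sign_mul', Real.sign_of_pos hA]
  · rw [Real.sign_of_neg ha, Real.sign_of_pos hb]; ring
  · simp [Real.sign_mul', Real.sign_of_pos hB]
  · simp
  · simp [Real.sign_mul', Real.sign_of_pos hB]
  · rw [Real.sign_of_pos ha, Real.sign_of_neg hb]; ring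
  · simp [Real.sign_mul', Real.sign_of_pos hA]
  · rw [Real.sign_of_pos ha, Real.sign_of_pos hb, Real.sign_of_pos (by positivity)]; norm_num

/-- The signs of the imaginary parts of a product of two complex numbers with nonzero real
parts. -/
lemma Real.sign_im_mul {p r : ℝ} (hp : p ≠ 0) (hr : r ≠ 0) (q s : ℝ) :
    Real.sign (p * r) * Real.sign (p * s + q * r) - Real.sign p * Real.sign q -
        Real.sign r * Real.sign s =
      -(Real.sign q * Real.sign s * Real.sign (p * s + q * r)) := by
  have h := Real.sign_pos_combination (pow_pos (abs_pos.2 hr) 2) (pow_pos (abs_pos.2 hp) 2)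
    (p * q) (r * s)
  have e : |r| ^ 2 * (p * q) + |p| ^ 2 * (r * s) = (p * r) * (p * s + q * r) := by
    simp only [sq_abs]; ring
  rw [e, Real.sign_mul' (p * r), Real.sign_mul' p q, Real.sign_mul' r s, Real.sign_mul' p r] at h
  have h1 := Real.sign_mul_self_of_ne_zero hp
  have h2 := Real.sign_mul_self_of_ne_zero hr
  rw [Real.sign_mul']
  linear_combination h - (Real.sign q * Real.sign s * Real.sign (p * s + q * r)) *
    (h1 * (Real.sign r * Real.sign r) + h2)

end RealSign

section Telescoping

lemma sum_ite_lt_eventually_right (s : Finset ℝ) (d : ℝ → ℝ) (x : ℝ) :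
    ∀ᶠ t in 𝓝[>] x, (∑ y ∈ s, if y < t then d y else 0) =
      (∑ y ∈ s, if y < x then d y else 0) + if x ∈ s then d x else 0 := by
  have h : ∀ᶠ t in 𝓝[>] x, ∀ y ∈ s, (y < t ↔ y ≤ x) := by
    rw [eventually_all_finset]
    intro y _
    rcases le_or_gt y x with hy | hy
    · filter_upwards [self_mem_nhdsWithin] with t ht
      exact ⟨fun _ => hy, fun h => lt_of_le_of_lt h ht⟩
    · filter_upwards [mem_nhdsWithin_of_mem_nhds (Iio_mem_nhds hy)] with t ht
      exact ⟨fun h => absurd h (not_lt.2 (le_of_lt ht)), fun h => absurd hy (not_lt.2 h)⟩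
  filter_upwards [h] with t ht
  rw [← Finset.sum_ite_eq' s x d, ← Finset.sum_add_distrib]
  refine Finset.sum_congr rfl fun y hy => ?_
  rw [if_congr (ht y hy) rfl rfl]
  rcases lt_trichotomy y x with h | h | h
  · simp [h, h.le, h.ne]
  · simp [h]
  · simp [h.not_ge, h.not_gt, h.ne']

lemma sum_ite_lt_eventually_left (s : Finset ℝ) (d : ℝ → ℝ) (x : ℝ) :
    ∀ᶠ t in 𝓝[<] x, (∑ y ∈ s, if y < t then d y else 0) =
      (∑ y ∈ s, if y < x then d y else 0) := by
  have h : ∀ᶠ t in 𝓝[<] x, ∀ y ∈ s, (y < t ↔ y < x) := by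
    rw [eventually_all_finset]
    intro y _
    rcases lt_or_ge y x with hy | hy
    · filter_upwards [mem_nhdsWithin_of_mem_nhds (Ioi_mem_nhds hy)] with t ht
      exact ⟨fun _ => hy, fun _ => ht⟩
    · filter_upwards [self_mem_nhdsWithin] with t ht
      exact ⟨fun h => h.trans ht, fun h => absurd h (not_lt.2 hy)⟩
  filter_upwards [h] with t ht
  exact Finset.sum_congr rfl fun y hy => if_congr (ht y hy) rfl rfl

/-- If `l` and `r` are the left and right limits of a function that is constant on one-sided
punctured neighbourhoods of every point, the jumps `r - l` telescope. -/
lemma sum_jumps_eq (l r : ℝ → ℝ) (hr : ∀ x, ∀ᶠ t in 𝓝[>] x, l t = r x)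
    (hl : ∀ x, ∀ᶠ t in 𝓝[<] x, l t = l x) (s : Finset ℝ)
    (hs : ∀ x, x ∉ s → r x = l x) {a b : ℝ} (hab : a < b) :
    r a + (∑ x ∈ s, if a < x ∧ x < b then r x - l x else 0) = l b := by
  set L : ℝ → ℝ := fun t => l t - ∑ x ∈ s, if x < t then r x - l x else 0 with hL
  have hloc : IsLocallyConstant L := by
    rw [IsLocallyConstant.iff_eventually_eq]
    intro x
    rw [← nhdsNE_sup_pure, ← nhdsLT_sup_nhdsGT, eventually_sup, eventually_sup]
    refine ⟨⟨?_, ?_⟩, by simp⟩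
    · filter_upwards [hl x, sum_ite_lt_eventually_left s (fun x => r x - l x) x] with t h1 h2
      simp only [hL, h1, h2]
    · filter_upwards [hr x, sum_ite_lt_eventually_right s (fun x => r x - l x) x] with t h1 h2
      simp only [hL, h1, h2]
      split_ifs with h
      · ring
      · rw [hs x h]; ring
  have hc := hloc.apply_eq_of_preconnectedSpace a b
  simp only [hL] at hc
  have hsum : (∑ x ∈ s, if x < b then r x - l x else 0) =
      (∑ x ∈ s, if x < a then r x - l x else 0) + (if a ∈ s then r a - l a else 0) +
        ∑ x ∈ s, if a < x ∧ x < b then r x - l x else 0 := by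
    rw [← Finset.sum_ite_eq' s a (fun x => r x - l x), ← Finset.sum_add_distrib,
      ← Finset.sum_add_distrib]
    refine Finset.sum_congr rfl fun x _ => ?_
    rcases lt_trichotomy x a with h | h | h
    · simp [h, h.trans hab, h.ne, h.not_gt]
    · simp [h, hab]
    · simp [h, h.not_gt, h.ne']
  have ha : (if a ∈ s then r a - l a else 0) = r a - l a := by
    split_ifs with h
    · rfl
    · rw [hs a h, sub_self]
  rw [hsum, ha] at hc
  linarith

end Telescoping

section SideSign

lemma unitEval_ne_zero {P : ℝ[X]} (hP : P ≠ 0) (x : ℝ) : unitEval P x ≠ 0 :=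
  eval_divByMonic_pow_rootMultiplicity_ne_zero x hP

@[simp] lemma unitEval_zero (x : ℝ) : unitEval 0 x = 0 := by simp [unitEval]

lemma unitEval_of_eval_ne_zero {P : ℝ[X]} {x : ℝ} (h : P.eval x ≠ 0) :
    unitEval P x = P.eval x := by
  simp [unitEval, rootMultiplicity_eq_zero (p := P) (x := x) h]

lemma unitEval_mul (P Q : ℝ[X]) (x : ℝ) :
    unitEval (P * Q) x = unitEval P x * unitEval Q x := by
  rcases eq_or_ne P 0 with rfl | hP
  · simp
  rcases eq_or_ne Q 0 with rfl | hQ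
  · simp
  have h : P * Q = (X - C x) ^ (rootMultiplicity x P + rootMultiplicity x Q) *
      ((P /ₘ (X - C x) ^ rootMultiplicity x P) * (Q /ₘ (X - C x) ^ rootMultiplicity x Q)) := by
    conv_lhs => rw [← pow_mul_divByMonic_rootMultiplicity_eq P x,
      ← pow_mul_divByMonic_rootMultiplicity_eq Q x]
    ring
  unfold unitEval
  rw [rootMultiplicity_mul (mul_ne_zero hP hQ), ← eval_mul]
  conv_lhs => rw [h]
  rw [mul_divByMonic_cancel_left _ ((monic_X_sub_C x).pow _)]

/-- The sign of `P` immediately to the right (`ε = 1`) or left (`ε = -1`) of `x`. -/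
noncomputable def sideSign (ε : ℝ) (P : ℝ[X]) (x : ℝ) : ℝ :=
  ε ^ rootMultiplicity x P * Real.sign (unitEval P x)

/-- The one-sided Cauchy index of `R / S` to the right (`ε = 1`) or left (`ε = -1`) of `x`. -/
noncomputable def sideIndex (ε : ℝ) (R S : ℝ[X]) (x : ℝ) : ℝ :=
  if rootMultiplicity x R < rootMultiplicity x S then
    (1 / 2) * ε ^ (rootMultiplicity x S - rootMultiplicity x R) *
      Real.sign (unitEval R x * unitEval S x)
  else 0

lemma indPlus_eq_sideIndex (R S : ℝ[X]) (x : ℝ) : indPlus R S x = sideIndex 1 R S x := by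
  simp [indPlus, sideIndex]

lemma indMinus_eq_sideIndex (R S : ℝ[X]) (x : ℝ) : indMinus R S x = sideIndex (-1) R S x := by
  simp [indMinus, sideIndex]

lemma sideIndex_zero_left (ε : ℝ) (S : ℝ[X]) (x : ℝ) : sideIndex ε 0 S x = 0 := by
  simp [sideIndex]

lemma sideIndex_of_eval_ne_zero (ε : ℝ) (R : ℝ[X]) {S : ℝ[X]} {x : ℝ} (h : S.eval x ≠ 0) :
    sideIndex ε R S x = 0 := by
  simp [sideIndex, rootMultiplicity_eq_zero (p := S) (x := x) h]

lemma sideIndex_zero_right (ε : ℝ) (R : ℝ[X]) (x : ℝ) : sideIndex ε R 0 x = 0 := by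
  simp [sideIndex]

lemma sideIndex_of_eval_eq_zero (ε : ℝ) {R S : ℝ[X]} {x : ℝ} (hR : R.eval x ≠ 0)
    (hS : S.eval x = 0) :
    sideIndex ε R S x = (1 / 2) * Real.sign (R.eval x) * sideSign ε S x := by
  rcases eq_or_ne S 0 with rfl | h0
  · simp [sideIndex, sideSign]
  have h1 : rootMultiplicity x R = 0 := rootMultiplicity_eq_zero hR
  have h2 : 0 < rootMultiplicity x S := (rootMultiplicity_pos h0).2 hS
  rw [sideIndex, h1, if_pos h2, unitEval_of_eval_ne_zero hR, Real.sign_mul', sideSign,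
    Nat.sub_zero]
  ring

lemma sideIndex_mul_left (ε : ℝ) {g : ℝ[X]} (hg : g ≠ 0) (R S : ℝ[X]) (x : ℝ) :
    sideIndex ε (g * R) (g * S) x = sideIndex ε R S x := by
  rcases eq_or_ne R 0 with rfl | hR
  · simp [sideIndex_zero_left]
  rcases eq_or_ne S 0 with rfl | hS
  · simp [sideIndex_zero_right]
  unfold sideIndex
  rw [rootMultiplicity_mul (mul_ne_zero hg hR), rootMultiplicity_mul (mul_ne_zero hg hS),
    unitEval_mul, unitEval_mul, Nat.add_sub_add_left]
  simp only [add_lt_add_iff_left, Real.sign_mul']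
  congr 1
  linear_combination (1 / 2 * ε ^ (rootMultiplicity x S - rootMultiplicity x R) *
    (Real.sign (unitEval R x) * Real.sign (unitEval S x))) *
    Real.sign_mul_self_of_ne_zero (unitEval_ne_zero hg x)

lemma sideSign_of_eval_ne_zero (ε : ℝ) {P : ℝ[X]} {x : ℝ} (h : P.eval x ≠ 0) :
    sideSign ε P x = Real.sign (P.eval x) := by
  rw [sideSign, unitEval_of_eval_ne_zero h, rootMultiplicity_eq_zero (p := P) h]
  simp

lemma sideSign_mul (ε : ℝ) (P Q : ℝ[X]) (x : ℝ) :
    sideSign ε (P * Q) x = sideSign ε P x * sideSign ε Q x := by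
  rcases eq_or_ne P 0 with rfl | hP
  · simp [sideSign]
  rcases eq_or_ne Q 0 with rfl | hQ
  · simp [sideSign]
  rw [sideSign, sideSign, sideSign, rootMultiplicity_mul (mul_ne_zero hP hQ), unitEval_mul,
    Real.sign_mul', pow_add]
  ring

lemma sideSign_mul_self {ε : ℝ} (hε : ε * ε = 1) {g : ℝ[X]} (hg : g ≠ 0) (x : ℝ) :
    sideSign ε g x * sideSign ε g x = 1 := by
  rw [sideSign, mul_mul_mul_comm, ← mul_pow, hε, one_pow,
    Real.sign_mul_self_of_ne_zero (unitEval_ne_zero hg x), one_mul]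

lemma eventually_sign_eval_eq {ε : ℝ} (hε : ε = 1 ∨ ε = -1) (P : ℝ[X]) (x : ℝ) :
    ∀ᶠ u in 𝓝[>] (0 : ℝ), Real.sign (P.eval (x + ε * u)) =
      sideSign ε P x := by
  rcases eq_or_ne P 0 with rfl | hP
  · simp [sideSign]
  set P₁ := P /ₘ (X - C x) ^ rootMultiplicity x P with hP₁
  have hcont : Tendsto (fun u : ℝ => P₁.eval x * P₁.eval (x + ε * u)) (𝓝[>] 0)
      (𝓝 (P₁.eval x * P₁.eval x)) := by
    have : Continuous fun u : ℝ => P₁.eval x * P₁.eval (x + ε * u) := by fun_prop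
    simpa using (this.tendsto 0).mono_left nhdsWithin_le_nhds
  have h1 : P₁.eval x ≠ 0 := unitEval_ne_zero hP x
  filter_upwards [hcont.eventually (lt_mem_nhds (mul_self_pos.2 h1)), self_mem_nhdsWithin]
    with u hu hu0
  have hs : Real.sign (P₁.eval (x + ε * u)) = Real.sign (P₁.eval x) := by
    have h2 := Real.sign_of_pos hu
    rw [Real.sign_mul'] at h2
    linear_combination Real.sign (P₁.eval x) * h2 -
      Real.sign (P₁.eval (x + ε * u)) * Real.sign_mul_self_of_ne_zero h1
  have hpow : ∀ n : ℕ, Real.sign ((ε * u) ^ n) = ε ^ n := by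
    intro n
    induction n with
    | zero => simp
    | succ n ih =>
      rw [pow_succ, Real.sign_mul', ih, Real.sign_mul', Real.sign_of_pos hu0, pow_succ]
      rcases hε with h | h <;> simp [h, Real.sign_neg]
  conv_lhs => rw [← pow_mul_divByMonic_rootMultiplicity_eq P x]
  rw [eval_mul, Real.sign_mul', ← hP₁, hs, sideSign, eval_pow, eval_sub, eval_X, eval_C,
    add_sub_cancel_left, hpow]
  rfl

end SideSign

section ProductFormula

/-- One-sided form of the product formula at a point where neither `P + iQ` nor `R + iS`
vanishes. -/
lemma sideIndex_mul_sub {ε : ℝ} (hε : ε = 1 ∨ ε = -1) {P Q R S : ℝ[X]} {x : ℝ}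
    (hF : P.eval x ≠ 0 ∨ Q.eval x ≠ 0) (hG : R.eval x ≠ 0 ∨ S.eval x ≠ 0) :
    sideIndex ε (P * R - Q * S) (P * S + Q * R) x - sideIndex ε P Q x - sideIndex ε R S x =
      -(1 / 2) * (sideSign ε (Q * S * (P * S + Q * R)) x -
        Real.sign ((Q * S * (P * S + Q * R)).eval x)) := by
  by_cases hQ : Q.eval x = 0
  · have hP : P.eval x ≠ 0 := hF.resolve_right (not_not.2 hQ)
    have hPs := Real.sign_mul_self_of_ne_zero hP
    rw [sideIndex_of_eval_eq_zero ε hP hQ, sideSign_mul, sideSign_mul]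
    by_cases hS : S.eval x = 0
    · have hR : R.eval x ≠ 0 := hG.resolve_right (not_not.2 hS)
      have hU : (P * R - Q * S).eval x ≠ 0 := by simp [hQ, hP, hR]
      rw [sideIndex_of_eval_eq_zero ε hR hS, sideIndex_of_eval_eq_zero ε hU (by simp [hQ, hS])]
      obtain ⟨u, hu⟩ := ((eventually_sign_eval_eq hε P x).and
        ((eventually_sign_eval_eq hε Q x).and ((eventually_sign_eval_eq hε R x).and
        ((eventually_sign_eval_eq hε S x).and
          (eventually_sign_eval_eq hε (P * S + Q * R) x))))).exists
      obtain ⟨h1, h2, h3, h4, h5⟩ := hu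
      rw [sideSign_of_eval_ne_zero ε hP] at h1
      rw [sideSign_of_eval_ne_zero ε hR] at h3
      have hne : ∀ {y z : ℝ}, y ≠ 0 → Real.sign z = Real.sign y → z ≠ 0 := by
        rintro y z hy h rfl
        exact hy (Real.sign_eq_zero_iff.1 (h.symm.trans Real.sign_zero))
      have key := Real.sign_im_mul (hne hP h1) (hne hR h3) (Q.eval (x + ε * u))
        (S.eval (x + ε * u))
      rw [eval_add, eval_mul, eval_mul] at h5
      rw [Real.sign_mul', h1, h2, h3, h4, h5] at key
      simp only [eval_sub, eval_mul, hQ, hS, zero_mul, sub_zero, Real.sign_zero, Real.sign_mul']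
      linear_combination (1 / 2) * key
    · have hV : (P * S + Q * R).eval x ≠ 0 := by simp [hQ, hP, hS]
      rw [sideIndex_of_eval_ne_zero ε _ hV, sideIndex_of_eval_ne_zero ε _ hS,
        sideSign_of_eval_ne_zero ε hS, sideSign_of_eval_ne_zero ε hV]
      simp only [eval_add, eval_mul, hQ, zero_mul, add_zero, Real.sign_zero, Real.sign_mul']
      linear_combination (1 / 2) * Real.sign (P.eval x) * sideSign ε Q x *
        Real.sign_mul_self_of_ne_zero hS
  · rw [sideIndex_of_eval_ne_zero ε _ hQ, sideSign_mul, sideSign_mul,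
      sideSign_of_eval_ne_zero ε hQ]
    by_cases hS : S.eval x = 0
    · have hR : R.eval x ≠ 0 := hG.resolve_right (not_not.2 hS)
      have hV : (P * S + Q * R).eval x ≠ 0 := by simp [hQ, hR, hS]
      rw [sideIndex_of_eval_ne_zero ε _ hV, sideIndex_of_eval_eq_zero ε hR hS,
        sideSign_of_eval_ne_zero ε hV]
      simp only [eval_add, eval_mul, hS, mul_zero, zero_mul, zero_add, Real.sign_zero,
        Real.sign_mul']
      linear_combination (1 / 2) * Real.sign (R.eval x) * sideSign ε S x *
        Real.sign_mul_self_of_ne_zero hQ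
    · rw [sideIndex_of_eval_ne_zero ε _ hS, sideSign_of_eval_ne_zero ε hS]
      by_cases hV : (P * S + Q * R).eval x = 0
      · have hneg : (P * R - Q * S).eval x * (Q.eval x * S.eval x) < 0 := by
          simp only [eval_add, eval_sub, eval_mul] at hV ⊢
          have h1 : 0 < (Q.eval x * S.eval x) ^ 2 := by positivity
          have h2 : (P.eval x * R.eval x - Q.eval x * S.eval x) * (Q.eval x * S.eval x) =
              -(Q.eval x * R.eval x) ^ 2 - (Q.eval x * S.eval x) ^ 2 := by
            linear_combination Q.eval x * R.eval x * hV
          linarith [sq_nonneg (Q.eval x * R.eval x)]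
        have hU : (P * R - Q * S).eval x ≠ 0 := left_ne_zero_of_mul hneg.ne
        have hs := Real.sign_of_neg hneg
        rw [Real.sign_mul', Real.sign_mul'] at hs
        rw [sideIndex_of_eval_eq_zero ε hU hV, eval_mul, hV, mul_zero, Real.sign_zero]
        have h1 := Real.sign_mul_self_of_ne_zero hQ
        have h2 := Real.sign_mul_self_of_ne_zero hS
        linear_combination (1 / 2) * sideSign ε (P * S + Q * R) x *
          (Real.sign (Q.eval x) * Real.sign (S.eval x) * hs -
          Real.sign ((P * R - Q * S).eval x) *
            (h1 * (Real.sign (S.eval x) * Real.sign (S.eval x)) + h2))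
      · rw [sideIndex_of_eval_ne_zero ε _ hV, sideSign_of_eval_ne_zero ε hV]
        rw [eval_mul (p := Q * S), eval_mul, Real.sign_mul', Real.sign_mul']
        ring

lemma exists_eq_mul_of_isCoprime {P Q : ℝ[X]} (h : P ≠ 0 ∨ Q ≠ 0) :
    ∃ g P₁ Q₁ : ℝ[X], g ≠ 0 ∧ P = g * P₁ ∧ Q = g * Q₁ ∧
      ∀ x, P₁.eval x ≠ 0 ∨ Q₁.eval x ≠ 0 := by
  classical
  have hg : EuclideanDomain.gcd P Q ≠ 0 := by
    rw [Ne, EuclideanDomain.gcd_eq_zero_iff]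
    tauto
  obtain ⟨P₁, hP⟩ := EuclideanDomain.gcd_dvd_left P Q
  obtain ⟨Q₁, hQ⟩ := EuclideanDomain.gcd_dvd_right P Q
  refine ⟨_, P₁, Q₁, hg, hP, hQ, fun x => ?_⟩
  have hb : 1 = P₁ * EuclideanDomain.gcdA P Q + Q₁ * EuclideanDomain.gcdB P Q := by
    apply mul_left_cancel₀ hg
    have := EuclideanDomain.gcd_eq_gcd_ab P Q
    linear_combination this + hP * EuclideanDomain.gcdA P Q + hQ * EuclideanDomain.gcdB P Q
  by_contra! hx
  simpa [hx.1, hx.2] using congrArg (eval x) hb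

/-- Local form of the product formula, allowing `P + iQ` and `R + iS` to vanish at `x`. -/
lemma indPoint_mul_sub {P Q R S : ℝ[X]} (hF : P ≠ 0 ∨ Q ≠ 0) (hG : R ≠ 0 ∨ S ≠ 0)
    (x : ℝ) :
    indPoint (P * R - Q * S) (P * S + Q * R) x - indPoint P Q x - indPoint R S x =
      -(1 / 2) * (sideSign 1 (Q * S * (P * S + Q * R)) x -
        sideSign (-1) (Q * S * (P * S + Q * R)) x) := by
  obtain ⟨g, P₁, Q₁, hg, rfl, rfl, hx⟩ := exists_eq_mul_of_isCoprime hF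
  obtain ⟨h, R₁, S₁, hh, rfl, rfl, hy⟩ := exists_eq_mul_of_isCoprime hG
  have e1 : g * P₁ * (h * R₁) - g * Q₁ * (h * S₁) = (g * h) * (P₁ * R₁ - Q₁ * S₁) := by ring
  have e2 : g * P₁ * (h * S₁) + g * Q₁ * (h * R₁) = (g * h) * (P₁ * S₁ + Q₁ * R₁) := by ring
  have hgh := mul_ne_zero hg hh
  have e3 : g * Q₁ * (h * S₁) * ((g * h) * (P₁ * S₁ + Q₁ * R₁)) =
      (g * h) * (g * h) * (Q₁ * S₁ * (P₁ * S₁ + Q₁ * R₁)) := by ring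
  simp only [indPoint, indPlus_eq_sideIndex, indMinus_eq_sideIndex]
  rw [e1, e2, e3]
  simp only [sideIndex_mul_left _ hgh, sideIndex_mul_left _ hg, sideIndex_mul_left _ hh]
  rw [sideSign_mul 1 (_ * _) (_ * _), sideSign_mul (-1) (_ * _) (_ * _), sideSign_mul 1 (g * h),
    sideSign_mul (-1) (g * h), sideSign_mul_self (by norm_num) hgh,
    sideSign_mul_self (by norm_num) hgh]
  linear_combination sideIndex_mul_sub (.inl rfl) (hx x) (hy x) -
    sideIndex_mul_sub (.inr rfl) (hx x) (hy x)

lemma indPoint_eq_zero_of_notMem_roots (R : ℝ[X]) {S : ℝ[X]} {x : ℝ}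
    (h : x ∉ S.roots.toFinset) : indPoint R S x = 0 := by
  simp only [indPoint, indPlus_eq_sideIndex, indMinus_eq_sideIndex]
  rcases eq_or_ne S 0 with rfl | hS
  · simp [sideIndex_zero_right]
  · have : S.eval x ≠ 0 := by simpa [hS] using h
    simp [sideIndex_of_eval_ne_zero _ R this]

lemma cauchyIndex_eq_sum (R S : ℝ[X]) (a b : ℝ) {s : Finset ℝ} (hs : S.roots.toFinset ⊆ s) :
    cauchyIndex R S a b = sideIndex 1 R S a +
      (∑ x ∈ s, if a < x ∧ x < b then indPoint R S x else 0) - sideIndex (-1) R S b := by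
  unfold cauchyIndex
  split_ifs with h
  · rcases h with rfl | rfl <;>
      simp [indPoint, indPlus_eq_sideIndex, indMinus_eq_sideIndex, sideIndex_zero_left,
        sideIndex_zero_right]
  · rw [indPlus_eq_sideIndex, indMinus_eq_sideIndex, Finset.sum_subset hs]
    intro x _ hx
    simp [indPoint_eq_zero_of_notMem_roots R hx]

lemma sideSign_jumps (W : ℝ[X]) {s : Finset ℝ} (hs : W.roots.toFinset ⊆ s) {a b : ℝ}
    (hab : a < b) :
    sideSign 1 W a + (∑ x ∈ s, if a < x ∧ x < b then sideSign 1 W x - sideSign (-1) W x else 0) =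
      sideSign (-1) W b := by
  have hside : ∀ {ε : ℝ}, (ε = 1 ∨ ε = -1) → ∀ x, ∀ᶠ u in 𝓝[>] (0 : ℝ),
      sideSign (-1) W (x + ε * u) = sideSign ε W x := by
    intro ε hε x
    rcases eq_or_ne W 0 with rfl | hW
    · simp [sideSign]
    filter_upwards [eventually_sign_eval_eq hε W x] with u hu
    rw [← hu, sideSign_of_eval_ne_zero]
    intro h0
    rw [h0, Real.sign_zero, sideSign, eq_comm, mul_eq_zero, Real.sign_eq_zero_iff] at hu
    rcases hu with h | h
    · rcases hε with rfl | rfl <;> simp at h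
    · exact unitEval_ne_zero hW x h
  refine sum_jumps_eq (sideSign (-1) W) (sideSign 1 W) (fun x => ?_) (fun x => ?_) s
    (fun x hx => ?_) hab
  · have ht : Tendsto (fun t : ℝ => t - x) (𝓝[>] x) (𝓝[>] 0) := by
      refine tendsto_nhdsWithin_iff.2 ⟨?_, ?_⟩
      · have : Continuous fun t : ℝ => t - x := by fun_prop
        simpa using (this.tendsto x).mono_left nhdsWithin_le_nhds
      · filter_upwards [self_mem_nhdsWithin] with t ht
        exact sub_pos.2 (Set.mem_Ioi.1 ht)
    filter_upwards [ht.eventually (hside (.inl rfl) x)] with t h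
    simpa using h
  · have ht : Tendsto (fun t : ℝ => x - t) (𝓝[<] x) (𝓝[>] 0) := by
      refine tendsto_nhdsWithin_iff.2 ⟨?_, ?_⟩
      · have : Continuous fun t : ℝ => x - t := by fun_prop
        simpa using (this.tendsto x).mono_left nhdsWithin_le_nhds
      · filter_upwards [self_mem_nhdsWithin] with t ht
        exact sub_pos.2 (Set.mem_Iio.1 ht)
    filter_upwards [ht.eventually (hside (.inr rfl) x)] with t h
    simpa using h
  · rcases eq_or_ne W 0 with rfl | hW
    · simp [sideSign]
    · have : W.eval x ≠ 0 := by simpa [hW] using fun h => hx (hs h)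
      rw [sideSign_of_eval_ne_zero _ this, sideSign_of_eval_ne_zero _ this]

/-- The product formula for Cauchy indices on an interval, with its boundary terms. -/
theorem cauchyIndex_mul {P Q R S : ℝ[X]} {a b : ℝ} (hab : a < b)
    (hFa : P.eval a ≠ 0 ∨ Q.eval a ≠ 0) (hGa : R.eval a ≠ 0 ∨ S.eval a ≠ 0)
    (hFb : P.eval b ≠ 0 ∨ Q.eval b ≠ 0) (hGb : R.eval b ≠ 0 ∨ S.eval b ≠ 0) :
    cauchyIndex (P * R - Q * S) (P * S + Q * R) a b =
      cauchyIndex P Q a b + cauchyIndex R S a b -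
        (1 / 2) * (Real.sign ((Q * S * (P * S + Q * R)).eval b) -
          Real.sign ((Q * S * (P * S + Q * R)).eval a)) := by
  have hF : P ≠ 0 ∨ Q ≠ 0 := hFa.imp (by rintro h rfl; simp at h) (by rintro h rfl; simp at h)
  have hG : R ≠ 0 ∨ S ≠ 0 := hGa.imp (by rintro h rfl; simp at h) (by rintro h rfl; simp at h)
  set V := P * S + Q * R with hV
  set W := Q * S * V with hW
  set s := (Q.roots.toFinset ∪ S.roots.toFinset) ∪ (V.roots.toFinset ∪ W.roots.toFinset)
  have hQs : Q.roots.toFinset ⊆ s := Finset.subset_union_left.trans Finset.subset_union_left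
  have hSs : S.roots.toFinset ⊆ s := Finset.subset_union_right.trans Finset.subset_union_left
  have hVs : V.roots.toFinset ⊆ s := Finset.subset_union_left.trans Finset.subset_union_right
  have hWs : W.roots.toFinset ⊆ s := Finset.subset_union_right.trans Finset.subset_union_right
  rw [cauchyIndex_eq_sum _ V a b hVs, cauchyIndex_eq_sum _ Q a b hQs,
    cauchyIndex_eq_sum _ S a b hSs]
  have hsum : (∑ x ∈ s, if a < x ∧ x < b then indPoint (P * R - Q * S) V x else 0) -
      (∑ x ∈ s, if a < x ∧ x < b then indPoint P Q x else 0) -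
      (∑ x ∈ s, if a < x ∧ x < b then indPoint R S x else 0) =
      -(1 / 2) * ∑ x ∈ s, if a < x ∧ x < b then sideSign 1 W x - sideSign (-1) W x else 0 := by
    rw [← Finset.sum_sub_distrib, ← Finset.sum_sub_distrib, Finset.mul_sum]
    refine Finset.sum_congr rfl fun x _ => ?_
    split_ifs
    · exact indPoint_mul_sub hF hG x
    · ring
  have ha := sideIndex_mul_sub (ε := 1) (.inl rfl) hFa hGa
  have hb := sideIndex_mul_sub (ε := -1) (.inr rfl) hFb hGb
  linear_combination hsum + ha - hb - (1 / 2) * sideSign_jumps W hWs hab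

end ProductFormula

section RePolyImPoly

lemma coeff_rePoly (p : ℂ[X]) (n : ℕ) : (rePoly p).coeff n = (p.coeff n).re := by
  simp +contextual [rePoly, Polynomial.sum, finsetSum_coeff, coeff_C_mul, coeff_X_pow]

lemma coeff_imPoly (p : ℂ[X]) (n : ℕ) : (imPoly p).coeff n = (p.coeff n).im := by
  simp +contextual [imPoly, Polynomial.sum, finsetSum_coeff, coeff_C_mul, coeff_X_pow]

lemma rePoly_mul (p q : ℂ[X]) :
    rePoly (p * q) = rePoly p * rePoly q - imPoly p * imPoly q := by
  ext n
  simp [coeff_rePoly, coeff_imPoly, coeff_mul, Finset.sum_sub_distrib]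

lemma imPoly_mul (p q : ℂ[X]) :
    imPoly (p * q) = rePoly p * imPoly q + imPoly p * rePoly q := by
  ext n
  simp [coeff_rePoly, coeff_imPoly, coeff_mul, Finset.sum_add_distrib]

lemma eval_rePoly (p : ℂ[X]) (t : ℝ) : (rePoly p).eval t = (p.eval (t : ℂ)).re := by
  rw [rePoly, eval_eq_sum (p := p), Polynomial.sum, Polynomial.sum, eval_finsetSum,
    Complex.re_sum]
  refine Finset.sum_congr rfl fun n _ => ?_
  rw [← Complex.ofReal_pow, Complex.re_mul_ofReal]
  simp

lemma eval_imPoly (p : ℂ[X]) (t : ℝ) : (imPoly p).eval t = (p.eval (t : ℂ)).im := by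
  rw [imPoly, eval_eq_sum (p := p), Polynomial.sum, Polynomial.sum, eval_finsetSum,
    Complex.im_sum]
  refine Finset.sum_congr rfl fun n _ => ?_
  rw [← Complex.ofReal_pow, Complex.im_mul_ofReal]
  simp

lemma eval_rePoly_ne_zero_or {p : ℂ[X]} {t : ℝ} (h : p.eval (t : ℂ) ≠ 0) :
    (rePoly p).eval t ≠ 0 ∨ (imPoly p).eval t ≠ 0 := by
  rw [eval_rePoly, eval_imPoly]
  by_contra! h'
  exact h (Complex.ext h'.1 h'.2)

end RePolyImPoly

section Segments

lemma segPolyXY_mul (F G : MvPolynomial (Fin 2) ℂ) (a b : ℂ) :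
    segPolyXY (F * G) a b = segPolyXY F a b * segPolyXY G a b := map_mul _ _ _

lemma eval_segPolyXY (F : MvPolynomial (Fin 2) ℂ) (a b : ℂ) (t : ℝ) :
    (segPolyXY F a b).eval (t : ℂ) =
      evalXY F (a.re + t * (b.re - a.re)) (a.im + t * (b.im - a.im)) := by
  rw [segPolyXY, evalXY, ← coe_aeval_eq_eval, MvPolynomial.comp_aeval_apply,
    ← MvPolynomial.aeval_eq_eval]
  refine congrArg (fun f => MvPolynomial.aeval f F) ?_
  funext j
  split_ifs <;> simp <;> ring

/-- The boundary term at a point in the product formula for indices along a segment. -/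
noncomputable def cornerTerm (F G : MvPolynomial (Fin 2) ℂ) (x y : ℝ) : ℝ :=
  Real.sign ((evalXY F x y).im * (evalXY G x y).im * (evalXY (F * G) x y).im)

lemma segIndexXY_mul {F G : MvPolynomial (Fin 2) ℂ} {a b : ℂ}
    (hFa : evalXY F a.re a.im ≠ 0) (hGa : evalXY G a.re a.im ≠ 0)
    (hFb : evalXY F b.re b.im ≠ 0) (hGb : evalXY G b.re b.im ≠ 0) :
    segIndexXY (F * G) a b = segIndexXY F a b + segIndexXY G a b -
      (1 / 4) * (cornerTerm F G b.re b.im - cornerTerm F G a.re a.im) := by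
  have e0 : ∀ H, (segPolyXY H a b).eval ((0 : ℝ) : ℂ) = evalXY H a.re a.im := fun H => by
    rw [eval_segPolyXY]; simp
  have e1 : ∀ H, (segPolyXY H a b).eval ((1 : ℝ) : ℂ) = evalXY H b.re b.im := fun H => by
    rw [eval_segPolyXY]; simp
  have key := cauchyIndex_mul zero_lt_one
    (eval_rePoly_ne_zero_or ((e0 F).trans_ne hFa)) (eval_rePoly_ne_zero_or ((e0 G).trans_ne hGa))
    (eval_rePoly_ne_zero_or ((e1 F).trans_ne hFb)) (eval_rePoly_ne_zero_or ((e1 G).trans_ne hGb))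
  rw [← rePoly_mul, ← imPoly_mul, ← segPolyXY_mul] at key
  simp only [eval_mul, eval_imPoly, e0, e1] at key
  unfold segIndexXY cornerTerm
  linear_combination (1 / 2) * key

end Segments

/-- Complex product formula: if neither `F` nor `G` (polynomials in two real variables
over `ℂ`) vanishes at any of the four vertices of the rectangle
`Γ = [x₀,x₁] × [y₀,y₁]`, then `ind_{∂Γ}(F·G) = ind_{∂Γ}(F) + ind_{∂Γ}(G)`. -/
theorem complex_product_formula (F G : MvPolynomial (Fin 2) ℂ)
    (x₀ x₁ y₀ y₁ : ℝ) (hx : x₀ < x₁) (hy : y₀ < y₁)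
    (hvert : ∀ x ∈ ({x₀, x₁} : Set ℝ), ∀ y ∈ ({y₀, y₁} : Set ℝ),
      evalXY F x y ≠ 0 ∧ evalXY G x y ≠ 0) :
    rectIndexXY (F * G) x₀ x₁ y₀ y₁ =
      rectIndexXY F x₀ x₁ y₀ y₁ + rectIndexXY G x₀ x₁ y₀ y₁ := by
  obtain ⟨hF00, hG00⟩ := hvert x₀ (by simp) y₀ (by simp)
  obtain ⟨hF10, hG10⟩ := hvert x₁ (by simp) y₀ (by simp)
  obtain ⟨hF11, hG11⟩ := hvert x₁ (by simp) y₁ (by simp)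
  obtain ⟨hF01, hG01⟩ := hvert x₀ (by simp) y₁ (by simp)
  have hre : ∀ x y : ℝ, ((x : ℂ) + y * Complex.I).re = x := by simp
  have him : ∀ x y : ℝ, ((x : ℂ) + y * Complex.I).im = y := by simp
  have seg : ∀ x y x' y' : ℝ, evalXY F x y ≠ 0 → evalXY G x y ≠ 0 → evalXY F x' y' ≠ 0 →
      evalXY G x' y' ≠ 0 →
      segIndexXY (F * G) (x + y * Complex.I) (x' + y' * Complex.I) =
        segIndexXY F (x + y * Complex.I) (x' + y' * Complex.I) +
        segIndexXY G (x + y * Complex.I) (x' + y' * Complex.I) -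
          (1 / 4) * (cornerTerm F G x' y' - cornerTerm F G x y) := by
    intro x y x' y' h1 h2 h3 h4
    have h := segIndexXY_mul (F := F) (G := G) (a := x + y * Complex.I)
      (b := x' + y' * Complex.I)
    simp only [hre, him] at h
    exact h h1 h2 h3 h4
  unfold rectIndexXY
  rw [seg _ _ _ _ hF00 hG00 hF10 hG10, seg _ _ _ _ hF10 hG10 hF11 hG11,
    seg _ _ _ _ hF11 hG11 hF01 hG01, seg _ _ _ _ hF01 hG01 hF00 hG00]
  ring
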